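/- Let Q be a finite set and let E = Q^n be equipped with the Hamming distance. For any finite nonempty set of points x_1, …, x_m ∈ E, their convex hull hull(x_1,…,x_m) equals the set of all x ∈ E such that for every coordinate i (1 ≤ i ≤ n), π_i(x) ∈ {π_i(x_1), …, π_i(x_m)}. -/

import Mathlib

variable {Q : Type*} [Fintype Q] [DecidableEq Q] {n : ℕ}

/-- The metric segment `[x,y]` in the Hamming space `Q^n`. -/
def hammingSeg (x y : Fin n → Q) : Set (Fin n → Q) :=
  {z | hammingDist x y = hammingDist x z + hammingDist z y}

/-- A subset `K ⊆ Q^n` is convex (for the Hamming metric) if it contains the segment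
between any two of its points. -/
def HammingConvex (K : Set (Fin n → Q)) : Prop :=
  ∀ x ∈ K, ∀ y ∈ K, hammingSeg x y ⊆ K

/-- The convex hull of `S ⊆ Q^n`: the smallest Hamming-convex set containing `S`,
i.e. the intersection of all convex sets containing `S`. -/
def hammingHull (S : Set (Fin n → Q)) : Set (Fin n → Q) :=
  ⋂₀ {K : Set (Fin n → Q) | HammingConvex K ∧ S ⊆ K}

/-- The Hamming segment is the set of points obtained by choosing each coordinate from one of
the two endpoints. -/
theorem mem_hammingSeg_iff {x y z : Fin n → Q} :
    z ∈ hammingSeg x y ↔ ∀ i, z i = x i ∨ z i = y i := by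
  have hle : ∀ i ∈ Finset.univ, (if x i ≠ y i then 1 else 0) ≤
      (if x i ≠ z i then 1 else 0) + (if z i ≠ y i then 1 else 0) := by
    intro i _
    split_ifs <;> simp_all
  simp only [hammingSeg, Set.mem_ofPred_eq, hammingDist, Finset.card_filter,
    ← Finset.sum_add_distrib]
  rw [Finset.sum_eq_sum_iff_of_le hle]
  refine forall_congr' fun i => ?_
  simp only [Finset.mem_univ, true_imp_iff]
  split_ifs <;> grind

/-- A product of sets of symbols is Hamming-convex. -/
theorem hammingConvex_pi (A : Fin n → Set Q) : HammingConvex {z | ∀ i, z i ∈ A i} := by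
  intro x hx y hy z hz i
  rcases mem_hammingSeg_iff.mp hz i with h | h
  · exact h ▸ hx i
  · exact h ▸ hy i

/-- Replacing one coordinate of a point of a convex set by that of another point of the set
yields a point of the set. -/
theorem HammingConvex.update_mem {K : Set (Fin n → Q)} (hK : HammingConvex K)
    {x y : Fin n → Q} (hx : x ∈ K) (hy : y ∈ K) (i : Fin n) :
    Function.update x i (y i) ∈ K := by
  refine hK x hx y hy (mem_hammingSeg_iff.mpr fun k => ?_)
  rcases eq_or_ne k i with rfl | h
  · simp
  · simp [h]

/-- A nonempty convex set contains every point each of whose coordinates is a coordinate of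
some point of the set. -/
theorem HammingConvex.mem_of_forall_coord {K : Set (Fin n → Q)} (hK : HammingConvex K)
    (hne : K.Nonempty) {z : Fin n → Q} (hz : ∀ i, ∃ y ∈ K, z i = y i) : z ∈ K := by
  have key : ∀ s : Finset (Fin n), ∃ w ∈ K, ∀ i ∈ s, w i = z i := by
    intro s
    induction s using Finset.induction_on with
    | empty => exact hne.imp fun w hw => ⟨hw, by simp⟩
    | insert i s _ ih =>
      obtain ⟨w, hw, hws⟩ := ih
      obtain ⟨y, hy, hzy⟩ := hz i
      refine ⟨_, hK.update_mem hw hy i, fun k hk => ?_⟩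
      rcases eq_or_ne k i with rfl | h
      · simp [hzy]
      · simpa [h] using hws k (Finset.mem_of_mem_insert_of_ne hk h)
  obtain ⟨w, hw, hwz⟩ := key Finset.univ
  exact funext (fun i => hwz i (Finset.mem_univ i)) ▸ hw

/-- For a finite nonempty family `x₁, …, xₘ ∈ Q^n`, the Hamming convex hull
`hull(x₁,…,xₘ)` is the set of `x` such that every coordinate of `x` belongs to
`{π_i(x₁), …, π_i(xₘ)}`. -/
theorem hammingHull_eq (m : ℕ) (hm : 0 < m) (x : Fin m → Fin n → Q) :
    hammingHull (Set.range x) =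
      {z : Fin n → Q | ∀ i : Fin n, ∃ j : Fin m, z i = x j i} := by
  refine Set.Subset.antisymm (Set.sInter_subset_of_mem ⟨?_, ?_⟩) ?_
  · exact hammingConvex_pi fun i => {q | ∃ j, q = x j i}
  · rintro _ ⟨j, rfl⟩ i
    exact ⟨j, rfl⟩
  · rintro z hz K ⟨hK, hxK⟩
    refine hK.mem_of_forall_coord ⟨x ⟨0, hm⟩, hxK ⟨_, rfl⟩⟩ fun i => ?_
    obtain ⟨j, hj⟩ := hz i
    exact ⟨x j, hxK ⟨j, rfl⟩, hj⟩
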